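/- (Soundness of reasoning with A1, A2, A3) If the reasoning algorithm with inference rules A1, A2, and A3, starting from the initial family of clause sets S₀ = {F}, yields a complete and clash-free family of clause sets Sₙ (a family to which no inference rule applies and whose clause sets contain neither an empty clause nor a pair of complementary unit clauses {L}, {L̄}), then the clause set F is satisfiable. -/

import Mathlib

/- Clause sets in ALC: a clause set is a finite set of clauses, a clause a
   finite set of concept literals (both represented by lists, with list
   membership as set membership, `++` as union and `filter` as removal). -/
namespace ALCCS

/-- Concept literals: A, ¬A, ∃R.F, ∀R.F where F is a clause set
    (concept names and role names are drawn from ℕ). -/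
inductive Lit : Type where
  | pos : ℕ → Lit                    -- concept name A
  | neg : ℕ → Lit                    -- negated concept name ¬A
  | ex  : ℕ → List (List Lit) → Lit  -- ∃R.F
  | all : ℕ → List (List Lit) → Lit  -- ∀R.F

/-- A clause: a finite set of concept literals (their disjunction). -/
abbrev Clause := List Lit
/-- A clause set: a finite set of clauses (their conjunction). -/
abbrev ClauseSet := List (List Lit)

/-- An interpretation with (nonempty) domain `D`. -/
structure Interp (D : Type) where
  cn  : ℕ → Set D
  rel : ℕ → D → D → Prop

mutual
/-- The extension L^I of a concept literal. -/
def litSem {D : Type} (I : Interp D) : Lit → Set D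
  | .pos a => I.cn a
  | .neg a => (I.cn a)ᶜ
  | .ex r F => {x | ∃ y, I.rel r x y ∧ y ∈ csSem I F}
  | .all r F => {x | ∀ y, I.rel r x y → y ∈ csSem I F}
/-- The extension of a clause: the union (disjunction) of its literals. -/
def clSem {D : Type} (I : Interp D) : List Lit → Set D
  | [] => ∅
  | L :: CL => litSem I L ∪ clSem I CL
/-- The extension of a clause set: the intersection (conjunction) of its clauses. -/
def csSem {D : Type} (I : Interp D) : List (List Lit) → Set D
  | [] => Set.univ
  | CL :: F => clSem I CL ∩ csSem I F
end

/-- A clause set is satisfiable if F^I ≠ ∅ for some interpretation. -/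
def Satisfiable (F : ClauseSet) : Prop :=
  ∃ (D : Type), Nonempty D ∧ ∃ I : Interp D, (csSem I F).Nonempty

/-- CNF of a disjunction of two clause sets (pairwise union of clauses). -/
def disjCS (F₁ F₂ : ClauseSet) : ClauseSet :=
  F₁.flatMap (fun c₁ => F₂.map (fun c₂ => c₁ ++ c₂))

mutual
/-- The complementary literal L̄: Ā = ¬A, (¬A)‾ = A, (∃R.F)‾ = ∀R.CNF(¬F),
    (∀R.F)‾ = ∃R.CNF(¬F). -/
def Lit.compl : Lit → Lit
  | .pos a => .neg a
  | .neg a => .pos a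
  | .ex r F => .all r (csNeg F)
  | .all r F => .ex r (csNeg F)
/-- CNF of the negation of a clause: the conjunction of the complements. -/
def clNeg : List Lit → List (List Lit)
  | [] => []
  | L :: CL => [L.compl] :: clNeg CL
/-- CNF(¬F) for a clause set F. -/
def csNeg : List (List Lit) → List (List Lit)
  | [] => [[]]
  | CL :: F => disjCS (clNeg CL) (csNeg F)
end

open Classical in
/-- Replace the clause `CL` by `newCL` in the clause set `F`. -/
noncomputable def replaceClause (F : ClauseSet) (CL newCL : Clause) : ClauseSet :=
  F.map (fun c => if c = CL then newCL else c)

open Classical in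
/-- Replace the clause set `F` by `F'` in the family `S`. -/
noncomputable def replaceCS (S : List ClauseSet) (F F' : ClauseSet) : List ClauseSet :=
  S.map (fun G => if G = F then F' else G)

open Classical in
/-- F \ {CL} : remove the clause `CL` from the clause set `F`. -/
noncomputable def removeClause (F : ClauseSet) (CL : Clause) : ClauseSet :=
  F.filter (fun c => decide (c ≠ CL))

open Classical in
/-- The effect of rule A2 (and A2⁺) on F for ∀R.F₁: remove from F all clauses
    containing ∀R.F₁ and replace every occurrence of ∃R.F₂ in clauses of F by
    ∃R.(F₁ ∪ F₂). -/
noncomputable def applyA2 (r : ℕ) (F₁ : ClauseSet) (F : ClauseSet) : ClauseSet :=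
  (F.filter (fun CL => decide (Lit.all r F₁ ∉ CL))).map
    (fun CL => CL.map (fun L => match L with
      | .ex r' F₂ => if r' = r then Lit.ex r' (F₁ ++ F₂) else Lit.ex r' F₂
      | L => L))

/-- A unit clause of the form {A}, {¬A}, or {∃R.F'}. -/
def IsA3Unit (CL : Clause) : Prop :=
  (∃ a, CL = [Lit.pos a]) ∨ (∃ a, CL = [Lit.neg a]) ∨ ∃ r F', CL = [Lit.ex r F']

/-- A family of clause sets is clash-free if none of its clause sets contains an
    empty clause or a pair {L}, {L̄} of complementary unit clauses. -/
def ClashFree (S : List ClauseSet) : Prop :=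
  ∀ F ∈ S, [] ∉ F ∧ ¬ ∃ L : Lit, [L] ∈ F ∧ [L.compl] ∈ F

/-- One derivation step Sᵢ → Sᵢ₊₁ of the reasoning algorithm with the inference
    rules A1, A2, and A3, acting on a clause set F ∈ Sᵢ. -/
inductive Step : List ClauseSet → List ClauseSet → Prop
  /-- (A1) if L ∈ CL for a clause CL of F (with |CL| ≥ 2), replace CL by {L} -/
  | a1 {S : List ClauseSet} {F : ClauseSet} {CL : Clause} {L : Lit} :
      F ∈ S → CL ∈ F → L ∈ CL → 2 ≤ CL.length →
      Step S (replaceCS S F (replaceClause F CL [L]))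
  /-- (A2) if ∀R.F₁ occurs in some clause of F, remove all clauses containing
      ∀R.F₁ and replace every ∃R.F₂ by ∃R.(F₁ ∪ F₂) -/
  | a2 {S : List ClauseSet} {F : ClauseSet} {CL : Clause} {r : ℕ} {F₁ : ClauseSet} :
      F ∈ S → CL ∈ F → Lit.all r F₁ ∈ CL →
      Step S (replaceCS S F (applyA2 r F₁ F))
  /-- (A3) if all clauses of F are unit clauses {A}, {¬A}, or {∃R.F'}, remove a
      unit clause {∃R.F₁} from F and add F₁ to the family -/
  | a3 {S : List ClauseSet} {F : ClauseSet} {r : ℕ} {F₁ : ClauseSet} :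
      F ∈ S → (∀ CL ∈ F, IsA3Unit CL) → [Lit.ex r F₁] ∈ F →
      Step S (replaceCS S F (removeClause F [Lit.ex r F₁]) ++ [F₁])

/-- A family is complete if no inference rule applies to it. -/
def Complete (S : List ClauseSet) : Prop := ¬ ∃ S', Step S S'

section Semantics

variable {D E : Type}

theorem mem_clSem (I : Interp D) (x : D) (C : List Lit) :
    x ∈ clSem I C ↔ ∃ L ∈ C, x ∈ litSem I L := by
  induction C with
  | nil => simp [clSem]
  | cons L C ih => simp [clSem, ih]

theorem mem_csSem (I : Interp D) (x : D) (F : List (List Lit)) :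
    x ∈ csSem I F ↔ ∀ C ∈ F, ∃ L ∈ C, x ∈ litSem I L := by
  induction F with
  | nil => simp [csSem]
  | cons C F ih => simp [csSem, mem_clSem, ih]

/-- A functional bisimulation between interpretations. -/
structure IsPMorphism (I : Interp D) (J : Interp E) (f : D → E) : Prop where
  cn : ∀ a x, f x ∈ J.cn a ↔ x ∈ I.cn a
  rel : ∀ r x z, J.rel r (f x) z ↔ ∃ y, z = f y ∧ I.rel r x y

mutual
theorem IsPMorphism.mem_litSem_iff {I : Interp D} {J : Interp E} {f : D → E}
    (h : IsPMorphism I J f) (x : D) : ∀ L : Lit, f x ∈ litSem J L ↔ x ∈ litSem I L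
  | .pos a => by simp only [litSem, h.cn]
  | .neg a => by simp only [litSem, Set.mem_compl_iff, h.cn]
  | .ex r F => by
    have ih := fun y => IsPMorphism.mem_csSem_iff h y F
    simp only [litSem, Set.mem_ofPred_eq, h.rel]
    constructor
    · rintro ⟨_, ⟨y, rfl, hy⟩, hF⟩
      exact ⟨y, hy, (ih y).1 hF⟩
    · rintro ⟨y, hy, hF⟩
      exact ⟨f y, ⟨y, rfl, hy⟩, (ih y).2 hF⟩
  | .all r F => by
    have ih := fun y => IsPMorphism.mem_csSem_iff h y F
    simp only [litSem, Set.mem_ofPred_eq, h.rel]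
    constructor
    · intro H y hy
      exact (ih y).1 (H _ ⟨y, rfl, hy⟩)
    · rintro H _ ⟨y, rfl, hy⟩
      exact (ih y).2 (H y hy)
theorem IsPMorphism.mem_clSem_iff {I : Interp D} {J : Interp E} {f : D → E}
    (h : IsPMorphism I J f) (x : D) : ∀ C : List Lit, f x ∈ clSem J C ↔ x ∈ clSem I C
  | [] => by simp [clSem]
  | L :: C => by
    have h₁ := IsPMorphism.mem_litSem_iff h x L
    have h₂ := IsPMorphism.mem_clSem_iff h x C
    simp only [clSem, Set.mem_union, h₁, h₂]
theorem IsPMorphism.mem_csSem_iff {I : Interp D} {J : Interp E} {f : D → E}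
    (h : IsPMorphism I J f) (x : D) :
    ∀ F : List (List Lit), f x ∈ csSem J F ↔ x ∈ csSem I F
  | [] => by simp [csSem]
  | C :: F => by
    have h₁ := IsPMorphism.mem_clSem_iff h x C
    have h₂ := IsPMorphism.mem_csSem_iff h x F
    simp only [csSem, Set.mem_inter_iff, h₁, h₂]
end

/-- The disjoint union of two interpretations. -/
def Interp.sum (I : Interp D) (J : Interp E) : Interp (D ⊕ E) where
  cn a := {z | Sum.elim (· ∈ I.cn a) (· ∈ J.cn a) z}
  rel r := Sum.LiftRel (I.rel r) (J.rel r)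

theorem isPMorphism_inl (I : Interp D) (J : Interp E) :
    IsPMorphism I (I.sum J) Sum.inl where
  cn a x := by simp [Interp.sum]
  rel r x z := by cases z <;> simp [Interp.sum]

theorem isPMorphism_inr (I : Interp D) (J : Interp E) :
    IsPMorphism J (I.sum J) Sum.inr where
  cn a x := by simp [Interp.sum]
  rel r x z := by cases z <;> simp [Interp.sum]

/-- The extension of `I` by a new root `none` that satisfies the concept names in `N`
and whose `r`-successors are given by `Q r`. -/
def Interp.withRoot (I : Interp D) (N : Set ℕ) (Q : ℕ → D → Prop) : Interp (Option D) where
  cn a := {z | z.elim (a ∈ N) (· ∈ I.cn a)}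
  rel r z w := w.elim False (fun y => z.elim (Q r y) (fun x => I.rel r x y))

theorem isPMorphism_some (I : Interp D) (N : Set ℕ) (Q : ℕ → D → Prop) :
    IsPMorphism I (I.withRoot N Q) some where
  cn a x := by simp [Interp.withRoot]
  rel r x z := by cases z <;> simp [Interp.withRoot]

variable (I : Interp D) (N : Set ℕ) (Q : ℕ → D → Prop)

theorem none_mem_litSem_pos (a : ℕ) :
    none ∈ litSem (I.withRoot N Q) (.pos a) ↔ a ∈ N := by
  simp [litSem, Interp.withRoot]

theorem none_mem_litSem_neg (a : ℕ) :
    none ∈ litSem (I.withRoot N Q) (.neg a) ↔ a ∉ N := by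
  simp [litSem, Interp.withRoot]

theorem none_mem_litSem_ex (r : ℕ) (F : ClauseSet) :
    none ∈ litSem (I.withRoot N Q) (.ex r F) ↔ ∃ y, Q r y ∧ y ∈ csSem I F := by
  simp only [litSem, Set.mem_ofPred_eq, Option.exists,
    (isPMorphism_some I N Q).mem_csSem_iff]
  simp [Interp.withRoot]

theorem none_mem_litSem_all (r : ℕ) (F : ClauseSet) :
    none ∈ litSem (I.withRoot N Q) (.all r F) ↔ ∀ y, Q r y → y ∈ csSem I F := by
  simp only [litSem, Set.mem_ofPred_eq, Option.forall,
    (isPMorphism_some I N Q).mem_csSem_iff]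
  simp [Interp.withRoot]

end Semantics

theorem Satisfiable.of_mem {D : Type} {I : Interp D} {x : D} {F : ClauseSet}
    (h : x ∈ csSem I F) : Satisfiable F :=
  ⟨D, ⟨x⟩, I, x, h⟩

theorem Satisfiable.of_replaceClause {F : ClauseSet} {C : Clause} {L : Lit} (hL : L ∈ C)
    (h : Satisfiable (replaceClause F C [L])) : Satisfiable F := by
  obtain ⟨D, -, I, x, hx⟩ := h
  refine .of_mem (I := I) (x := x) ((mem_csSem _ _ _).2 fun K hK => ?_)
  rw [mem_csSem] at hx
  have := hx _ (List.mem_map_of_mem hK)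
  split_ifs at this with hKC
  · subst hKC
    exact ⟨L, hL, by simpa using this⟩
  · exact this

theorem Satisfiable.of_applyA2 {r : ℕ} {F₁ F : ClauseSet}
    (h : Satisfiable (applyA2 r F₁ F)) : Satisfiable F := by
  obtain ⟨D, -, I, x, hx⟩ := h
  rw [mem_csSem] at hx
  refine .of_mem (I := I.withRoot {a | x ∈ I.cn a}
    fun r' y => I.rel r' x y ∧ (r' = r → y ∈ csSem I F₁)) (x := none)
    ((mem_csSem _ _ _).2 fun C hC => ?_)
  by_cases hall : Lit.all r F₁ ∈ C
  · refine ⟨_, hall, (none_mem_litSem_all ..).2 fun y hy => hy.2 rfl⟩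
  · obtain ⟨L', hL', hxL⟩ := hx _ (List.mem_map_of_mem
      (List.mem_filter.2 ⟨hC, by simpa using hall⟩))
    obtain ⟨L, hL, rfl⟩ := List.mem_map.1 hL'
    refine ⟨L, hL, ?_⟩
    cases L with
    | pos a => exact (none_mem_litSem_pos ..).2 (by simpa [litSem] using hxL)
    | neg a => exact (none_mem_litSem_neg ..).2 (by simpa [litSem] using hxL)
    | all r' G =>
      rw [none_mem_litSem_all]
      exact fun y hy => hxL y hy.1
    | ex r' G =>
      rw [none_mem_litSem_ex]
      by_cases hr : r' = r
      · simp only [if_pos hr] at hxL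
        obtain ⟨y, hy, hF⟩ := hxL
        simp only [mem_csSem, List.mem_append, or_imp, forall_and] at hF
        exact ⟨y, ⟨hy, fun _ => (mem_csSem _ _ _).2 hF.1⟩, (mem_csSem _ _ _).2 hF.2⟩
      · simp only [if_neg hr] at hxL
        obtain ⟨y, hy, hF⟩ := hxL
        exact ⟨y, ⟨hy, fun h => absurd h hr⟩, hF⟩

theorem Satisfiable.of_removeClause_ex {r : ℕ} {F₁ F : ClauseSet}
    (hunit : ∀ C ∈ F, IsA3Unit C) (h : Satisfiable (removeClause F [Lit.ex r F₁]))
    (h₁ : Satisfiable F₁) : Satisfiable F := by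
  obtain ⟨D, -, I, x, hx⟩ := h
  obtain ⟨E, -, J, y, hy⟩ := h₁
  rw [mem_csSem] at hx
  refine .of_mem (I := (I.sum J).withRoot {a | x ∈ I.cn a}
    fun r' z => (I.sum J).rel r' (.inl x) z ∨ r' = r ∧ z = .inr y) (x := none)
    ((mem_csSem _ _ _).2 fun C hC => ?_)
  by_cases hCr : C = [Lit.ex r F₁]
  · subst hCr
    refine ⟨_, List.mem_singleton_self _, (none_mem_litSem_ex ..).2 ⟨.inr y, .inr ⟨rfl, rfl⟩, ?_⟩⟩
    exact ((isPMorphism_inr I J).mem_csSem_iff y F₁).2 hy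
  · have hxC := hx C (List.mem_filter.2 ⟨hC, by simpa using hCr⟩)
    rcases hunit C hC with ⟨a, rfl⟩ | ⟨a, rfl⟩ | ⟨r', G, rfl⟩
    · exact ⟨_, List.mem_singleton_self _, (none_mem_litSem_pos ..).2 (by simpa [litSem] using hxC)⟩
    · exact ⟨_, List.mem_singleton_self _, (none_mem_litSem_neg ..).2 (by simpa [litSem] using hxC)⟩
    · obtain ⟨L, hL, hxL⟩ := hxC
      obtain rfl := List.mem_singleton.1 hL
      obtain ⟨z, hz, hG⟩ := hxL
      refine ⟨_, hL, (none_mem_litSem_ex ..).2 ⟨.inl z, .inl ?_, ?_⟩⟩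
      · exact ((isPMorphism_inl I J).rel r' x _).2 ⟨z, rfl, hz⟩
      · exact ((isPMorphism_inl I J).mem_csSem_iff z G).2 hG

theorem forall_satisfiable_of_replaceCS {S : List ClauseSet} {F F' : ClauseSet}
    (himp : Satisfiable F' → Satisfiable F)
    (h : ∀ G ∈ replaceCS S F F', Satisfiable G) : ∀ G ∈ S, Satisfiable G := by
  intro G hG
  have := h _ (List.mem_map_of_mem hG)
  split_ifs at this with hGF
  · exact hGF ▸ himp this
  · exact this

theorem Step.forall_satisfiable {S S' : List ClauseSet} (hstep : Step S S')
    (h : ∀ G ∈ S', Satisfiable G) : ∀ G ∈ S, Satisfiable G := by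
  cases hstep with
  | a1 _ _ hL _ => exact forall_satisfiable_of_replaceCS (.of_replaceClause hL) h
  | a2 _ _ _ => exact forall_satisfiable_of_replaceCS .of_applyA2 h
  | a3 _ hunit _ =>
    exact forall_satisfiable_of_replaceCS
      (fun h' => .of_removeClause_ex hunit h' (h _ (by simp)))
      fun G hG => h G (List.mem_append_left _ hG)

theorem Complete.satisfiable {S : List ClauseSet} (hS : Complete S) (hclash : ClashFree S)
    {F : ClauseSet} (hF : F ∈ S) : Satisfiable F := by
  have hall : ∀ C ∈ F, ∀ r G, Lit.all r G ∉ C := fun C hC r G hL => hS ⟨_, .a2 hF hC hL⟩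
  have hunit : ∀ C ∈ F, IsA3Unit C := by
    intro C hC
    match C, hC with
    | [], hC => exact absurd hC (hclash F hF).1
    | [.pos a], _ => exact .inl ⟨a, rfl⟩
    | [.neg a], _ => exact .inr (.inl ⟨a, rfl⟩)
    | [.ex r G], _ => exact .inr (.inr ⟨r, G, rfl⟩)
    | [.all r G], hC => exact absurd (List.mem_singleton_self _) (hall _ hC r G)
    | L :: M :: C, hC => exact absurd ⟨_, .a1 hF hC List.mem_cons_self (by simp)⟩ hS
  refine .of_mem (I := { cn := fun a => {_x | [Lit.pos a] ∈ F}, rel := fun _ _ _ => False })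
    (x := ()) ((mem_csSem _ _ _).2 fun C hC => ?_)
  rcases hunit C hC with ⟨a, rfl⟩ | ⟨a, rfl⟩ | ⟨r, G, rfl⟩
  · exact ⟨_, List.mem_singleton_self _, hC⟩
  · refine ⟨_, List.mem_singleton_self _, fun hpos => (hclash F hF).2 ⟨.pos a, hpos, ?_⟩⟩
    simpa [Lit.compl] using hC
  · exact absurd ⟨_, .a3 hF hunit hC⟩ hS

/-- Soundness of reasoning with A1, A2, A3: if from S₀ = {F} the
    algorithm derives a complete and clash-free family of clause sets Sₙ, then
    F is satisfiable. -/
theorem soundness_A1_A2_A3 (F : ClauseSet) (Sn : List ClauseSet)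
    (hderiv : Relation.ReflTransGen Step [F] Sn)
    (hcomplete : Complete Sn) (hclashfree : ClashFree Sn) :
    Satisfiable F := by
  have key : ∀ S, Relation.ReflTransGen Step S Sn → ∀ G ∈ S, Satisfiable G := by
    intro S hS
    induction hS using Relation.ReflTransGen.head_induction_on with
    | refl => exact fun G hG => hcomplete.satisfiable hclashfree hG
    | head hstep _ ih => exact hstep.forall_satisfiable ih
  exact key [F] hderiv F (List.mem_singleton_self F)

end ALCCS
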